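/- For the cyclic dynamics with p = 1/2 and t(n) = ⌈(2/3) n log n⌉, there is a constant C > 0 independent of n, r and σ_0 such that for every r > 0 and every σ_0 ∈ Σ_n, ℙ_{σ_0}( S_{t(n)} ∉ S^{r/√n} ) ≤ C/r, i.e. ℙ_{σ_0}( ‖Ŝ_{t(n)}‖_∞ ≥ r/√n ) ≤ C/r. -/

import Mathlib

open Finset
open scoped Classical

/-- Configuration space `Σ_n = {1,2,3}^{V_n}`, colors encoded as `Fin 3`. -/
abbrev Config (n : ℕ) := Fin n → Fin 3

/-- Transition matrix of the cyclic dynamics with parameter `p` on `Σ_n`. -/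
noncomputable def cyclicP (n : ℕ) (p : ℝ) : Matrix (Config n) (Config n) ℝ :=
  Matrix.of fun σ τ => (1 / (n : ℝ)) * ∑ v : Fin n,
    ((1 - p) * (if τ = σ then (1 : ℝ) else 0)
      + p * (if τ = Function.update σ v (σ v + 1) then (1 : ℝ) else 0))

/-- Law of the chain at time `t` started from `σ0`. -/
noncomputable def lawAt (n : ℕ) (p : ℝ) (σ0 : Config n) (t : ℕ) : Config n → ℝ :=
  fun τ => ((cyclicP n p) ^ t) σ0 τ

/-- Proportion vector `S(σ) ∈ ℝ³`. -/
noncomputable def propVec {n : ℕ} (σ : Config n) : Fin 3 → ℝ :=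
  fun k => ((univ.filter fun v => σ v = k).card : ℝ) / n

/-- Membership in `S^ρ = {s ∈ S : ‖s − ē‖_∞ < ρ}`, where `S` is the probability
simplex in `ℝ³` and `ē = (1/3,1/3,1/3)`. -/
def inS (ρ : ℝ) (s : Fin 3 → ℝ) : Prop :=
  (∀ k, 0 ≤ s k) ∧ (∑ k, s k) = 1 ∧ (∀ k, |s k - 1/3| < ρ)

open scoped Matrix

/-- The number of vertices of color `k`. -/
noncomputable def colorCount {n : ℕ} (σ : Config n) (k : Fin 3) : ℝ :=
  ∑ v, if σ v = k then (1 : ℝ) else 0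

/-- Squared Euclidean distance of the color counts from equidistribution. -/
noncomputable def imbalance {n : ℕ} (σ : Config n) : ℝ :=
  ∑ k, (colorCount σ k - n / 3) ^ 2

theorem propVec_eq_colorCount_div {n : ℕ} (σ : Config n) (k : Fin 3) :
    propVec σ k = colorCount σ k / n := by
  simp [propVec, colorCount]

theorem colorCount_nonneg {n : ℕ} (σ : Config n) (k : Fin 3) : 0 ≤ colorCount σ k :=
  Finset.sum_nonneg fun v _ => by split_ifs <;> norm_num

theorem sum_comp_config {n : ℕ} (σ : Config n) (h : Fin 3 → ℝ) :
    ∑ v, h (σ v) = ∑ k, colorCount σ k * h k := by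
  simp only [colorCount, Finset.sum_mul]
  rw [Finset.sum_comm]
  simp

theorem sum_colorCount {n : ℕ} (σ : Config n) : ∑ k, colorCount σ k = n := by
  simpa using (sum_comp_config σ fun _ => 1).symm

theorem colorCount_update {n : ℕ} (σ : Config n) (v : Fin n) (c k : Fin 3) :
    colorCount (Function.update σ v c) k =
      colorCount σ k - (if σ v = k then 1 else 0) + (if c = k then 1 else 0) := by
  simp only [colorCount]
  rw [← Finset.add_sum_erase _ _ (mem_univ v),
    ← Finset.add_sum_erase _ (fun w => if σ w = k then (1 : ℝ) else 0) (mem_univ v)]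
  have : ∀ w ∈ univ.erase v, (if Function.update σ v c w = k then (1 : ℝ) else 0) =
      if σ w = k then 1 else 0 := by
    intro w hw
    rw [Function.update_of_ne (Finset.ne_of_mem_erase hw)]
  rw [Finset.sum_congr rfl this, Function.update_self]
  ring

theorem imbalance_update_succ {n : ℕ} (σ : Config n) (v : Fin n) :
    imbalance (Function.update σ v (σ v + 1)) =
      imbalance σ + 2 * (colorCount σ (σ v + 1) - colorCount σ (σ v)) + 2 := by
  simp only [imbalance, colorCount_update, Fin.sum_univ_three]
  generalize σ v = c
  fin_cases c <;> simp <;> ring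

theorem imbalance_le {n : ℕ} (σ : Config n) : imbalance σ ≤ 2 / 3 * (n : ℝ) ^ 2 := by
  have hsum := sum_colorCount σ
  have h0 := colorCount_nonneg σ 0
  have h1 := colorCount_nonneg σ 1
  have h2 := colorCount_nonneg σ 2
  simp only [imbalance, Fin.sum_univ_three] at *
  rw [← hsum]
  nlinarith [mul_nonneg h0 h1, mul_nonneg h1 h2, mul_nonneg h0 h2]

theorem cyclicP_mulVec {n : ℕ} (p : ℝ) (g : Config n → ℝ) (σ : Config n) :
    (cyclicP n p *ᵥ g) σ =
      1 / (n : ℝ) * ∑ v, ((1 - p) * g σ + p * g (Function.update σ v (σ v + 1))) := by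
  simp only [Matrix.mulVec, dotProduct, cyclicP, Matrix.of_apply, mul_assoc, Finset.sum_mul]
  rw [← Finset.mul_sum, Finset.sum_comm]
  simp [add_mul, Finset.sum_add_distrib, ← Finset.mul_sum]

theorem cyclicP_nonneg {n : ℕ} {p : ℝ} (hp0 : 0 ≤ p) (hp1 : p ≤ 1) (σ τ : Config n) :
    0 ≤ cyclicP n p σ τ := by
  have : 0 ≤ 1 - p := sub_nonneg.2 hp1
  simp only [cyclicP, Matrix.of_apply]
  positivity

theorem lawAt_nonneg {n : ℕ} {p : ℝ} (hp0 : 0 ≤ p) (hp1 : p ≤ 1) (σ₀ : Config n) (t : ℕ)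
    (τ : Config n) : 0 ≤ lawAt n p σ₀ t τ := by
  simp only [lawAt]
  induction t generalizing τ with
  | zero => rw [pow_zero, Matrix.one_apply]; split_ifs <;> norm_num
  | succ t ih =>
    rw [pow_succ, Matrix.mul_apply]
    exact Finset.sum_nonneg fun ρ _ => mul_nonneg (ih ρ) (cyclicP_nonneg hp0 hp1 ρ τ)

/-- The expectation of an eigenfunction of the transition matrix decays geometrically. -/
theorem sum_lawAt_mul_of_mulVec_eq_smul {n : ℕ} {p c : ℝ} {g : Config n → ℝ}
    (hg : cyclicP n p *ᵥ g = c • g) (σ₀ : Config n) (t : ℕ) :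
    ∑ τ, lawAt n p σ₀ t τ * g τ = c ^ t * g σ₀ := by
  have key : (cyclicP n p ^ t) *ᵥ g = c ^ t • g := by
    induction t with
    | zero => simp
    | succ t ih => rw [pow_succ, ← Matrix.mulVec_mulVec, hg, Matrix.mulVec_smul, ih, smul_smul,
        pow_succ']
  simpa [Matrix.mulVec, dotProduct, lawAt] using congrFun key σ₀

theorem sum_lawAt {n : ℕ} (hn : 1 ≤ n) (p : ℝ) (σ₀ : Config n) (t : ℕ) :
    ∑ τ, lawAt n p σ₀ t τ = 1 := by
  have hn' : (n : ℝ) ≠ 0 := by positivity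
  have h : cyclicP n p *ᵥ (fun _ => 1) = (1 : ℝ) • (fun _ => (1 : ℝ)) := by
    funext σ
    rw [cyclicP_mulVec]
    simp [hn']
  simpa using sum_lawAt_mul_of_mulVec_eq_smul h σ₀ t

theorem cyclicP_half_mulVec_imbalance_sub {n : ℕ} (hn : 1 ≤ n) :
    cyclicP n (1 / 2) *ᵥ (fun σ => imbalance σ - 2 / 3 * n) =
      (1 - 3 / (2 * n) : ℝ) • fun σ => imbalance σ - 2 / 3 * n := by
  have hn' : (n : ℝ) ≠ 0 := by positivity
  funext σ
  let h : Fin 3 → ℝ := fun k =>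
    imbalance σ - 2 / 3 * n + 1 + (colorCount σ (k + 1) - colorCount σ k)
  have hstep : ∀ v, (1 - 1 / 2 : ℝ) * (imbalance σ - 2 / 3 * n) +
      1 / 2 * (imbalance (Function.update σ v (σ v + 1)) - 2 / 3 * n) =
      h (σ v) := by
    intro v
    simp only [h, imbalance_update_succ]
    ring
  rw [cyclicP_mulVec, Finset.sum_congr rfl fun v _ => hstep v, sum_comp_config σ h]
  have hsum := sum_colorCount σ
  simp only [h, Fin.sum_univ_three, imbalance, Pi.smul_apply, smul_eq_mul] at *
  have e1 : (0 : Fin 3) + 1 = 1 := rfl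
  have e2 : (1 : Fin 3) + 1 = 2 := rfl
  have e3 : (2 : Fin 3) + 1 = 0 := rfl
  rw [e1, e2, e3]
  have hz : colorCount σ 2 = n - colorCount σ 0 - colorCount σ 1 := by linarith
  rw [hz]
  field_simp
  ring

theorem decay_at_mixing_time {n : ℕ} (hn : 1 ≤ n) :
    0 ≤ (1 - 3 / (2 * n) : ℝ) ^ ⌈(2 / 3) * n * Real.log n⌉₊ ∧
      (1 - 3 / (2 * n) : ℝ) ^ ⌈(2 / 3) * n * Real.log n⌉₊ ≤ 1 / n := by
  rcases hn.eq_or_lt with rfl | hn2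
  · simp
  have hn0 : (0 : ℝ) < n := by positivity
  have hn2' : (2 : ℝ) ≤ n := by exact_mod_cast hn2
  have hbase : (0 : ℝ) ≤ 1 - 3 / (2 * n) := by
    rw [sub_nonneg, div_le_one (by positivity)]
    linarith
  set t := ⌈(2 / 3) * n * Real.log n⌉₊
  have ht : (2 / 3) * n * Real.log n ≤ t := Nat.le_ceil _
  refine ⟨pow_nonneg hbase t, ?_⟩
  calc (1 - 3 / (2 * n) : ℝ) ^ t ≤ Real.exp (-(3 / (2 * n))) ^ t :=
        pow_le_pow_left₀ hbase (Real.one_sub_le_exp_neg _) _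
    _ = Real.exp (-(3 / (2 * n) * t)) := by rw [← Real.exp_nat_mul]; ring_nf
    _ ≤ Real.exp (-Real.log n) := by
        apply Real.exp_le_exp.2 (neg_le_neg _)
        calc Real.log n = 3 / (2 * n) * ((2 / 3) * n * Real.log n) := by field_simp
          _ ≤ _ := by gcongr
    _ = 1 / n := by rw [Real.exp_neg, Real.exp_log hn0, one_div]

theorem sum_lawAt_mul_imbalance_le {n : ℕ} (hn : 1 ≤ n) (σ₀ : Config n) :
    ∑ τ, lawAt n (1 / 2) σ₀ ⌈(2 / 3) * n * Real.log n⌉₊ τ * imbalance τ ≤ 2 * n := by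
  have hE := sum_lawAt_mul_of_mulVec_eq_smul (cyclicP_half_mulVec_imbalance_sub hn) σ₀
    ⌈(2 / 3) * n * Real.log n⌉₊
  obtain ⟨hq0, hq⟩ := decay_at_mixing_time hn
  simp only [mul_sub, Finset.sum_sub_distrib, ← Finset.sum_mul, sum_lawAt hn] at hE
  rw [← mul_sub] at hE
  set q := (1 - 3 / (2 * n) : ℝ) ^ ⌈(2 / 3) * n * Real.log n⌉₊
  have hbound : q * (imbalance σ₀ - 2 / 3 * n) ≤ 2 / 3 * n :=
    calc q * (imbalance σ₀ - 2 / 3 * n) ≤ q * (2 / 3 * (n : ℝ) ^ 2) := by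
          gcongr
          linarith [imbalance_le σ₀]
      _ ≤ 1 / n * (2 / 3 * (n : ℝ) ^ 2) := by gcongr
      _ = 2 / 3 * n := by field_simp
  linarith

theorem sq_le_imbalance_of_not_inS {n : ℕ} (hn : 1 ≤ n) {r : ℝ} (hr : 0 < r) {τ : Config n}
    (h : ¬ inS (r / Real.sqrt n) (propVec τ)) : r ^ 2 * n ≤ imbalance τ := by
  have hn0 : (0 : ℝ) < n := by positivity
  have hmem : ∃ k, r / Real.sqrt n ≤ |propVec τ k - 1 / 3| := by
    by_contra! hlt
    refine h ⟨fun k => ?_, ?_, hlt⟩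
    · rw [propVec_eq_colorCount_div]
      exact div_nonneg (colorCount_nonneg τ k) hn0.le
    · simp only [propVec_eq_colorCount_div, ← Finset.sum_div, sum_colorCount]
      exact div_self hn0.ne'
  obtain ⟨k, hk⟩ := hmem
  have hsq : r ^ 2 / n ≤ (propVec τ k - 1 / 3) ^ 2 := by
    have := pow_le_pow_left₀ (by positivity) hk 2
    rwa [div_pow, Real.sq_sqrt hn0.le, sq_abs] at this
  calc r ^ 2 * n = r ^ 2 / n * n ^ 2 := by field_simp
    _ ≤ (propVec τ k - 1 / 3) ^ 2 * n ^ 2 := by gcongr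
    _ = (colorCount τ k - n / 3) ^ 2 := by
        rw [propVec_eq_colorCount_div]
        field_simp
    _ ≤ imbalance τ := Finset.single_le_sum (f := fun k => (colorCount τ k - n / 3) ^ 2)
        (fun _ _ => sq_nonneg _) (mem_univ k)

/-- for `t(n) = ⌈(2/3) n log n⌉`, there is a constant `C > 0` such
that `ℙ_{σ0}(S_{t(n)} ∉ S^{r/√n}) ≤ C/r` for every `r > 0` and every start `σ0`. -/
theorem proportion_chain_at_mixing_time_concentration :
    ∃ C : ℝ, 0 < C ∧ ∀ n : ℕ, 1 ≤ n → ∀ r : ℝ, 0 < r → ∀ σ0 : Config n,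
      (∑ τ : Config n,
          if ¬ inS (r / Real.sqrt n) (propVec τ) then
            lawAt n (1/2) σ0 ⌈(2/3) * n * Real.log n⌉₊ τ
          else 0)
        ≤ C / r := by
  refine ⟨2, two_pos, fun n hn r hr σ0 => ?_⟩
  have hn0 : (0 : ℝ) < n := by positivity
  set t := ⌈(2/3) * n * Real.log n⌉₊ with ht
  have hlaw := lawAt_nonneg (p := 1 / 2) (by norm_num) (by norm_num) σ0 t
  -- On the bad event, `2 r ≤ 1 + r ^ 2 ≤ 1 + imbalance τ / n`.
  have hpt : ∀ τ, (if ¬ inS (r / Real.sqrt n) (propVec τ) then lawAt n (1/2) σ0 t τ else 0) ≤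
      (lawAt n (1/2) σ0 t τ + lawAt n (1/2) σ0 t τ * imbalance τ / n) / (2 * r) := by
    intro τ
    have hQ : 0 ≤ imbalance τ := Finset.sum_nonneg fun _ _ => sq_nonneg _
    have hl := hlaw τ
    split_ifs with h
    · positivity
    · have hle : r ^ 2 ≤ imbalance τ / n := by
        rw [le_div_iff₀ hn0]
        exact sq_le_imbalance_of_not_inS hn hr h
      rw [le_div_iff₀ (by positivity), mul_div_assoc]
      nlinarith [sq_nonneg (r - 1)]
  refine (Finset.sum_le_sum fun τ _ => hpt τ).trans ?_
  rw [← Finset.sum_div, Finset.sum_add_distrib, ← Finset.sum_div, sum_lawAt hn]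
  have hE := sum_lawAt_mul_imbalance_le hn σ0
  rw [← ht, ← div_le_iff₀ hn0] at hE
  rw [div_le_div_iff₀ (by positivity) hr]
  nlinarith
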